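/- Let F ⊆ {0,1}^* be the set of words {0 1^n 0 : the n-th Turing machine halts on empty input}, and let Σ = T_F ⊆ {0,1}^Z be the corresponding effective subshift. Then for every recursive (total computable) function ψ : N → N and every sofic realization of Σ by projective subaction of a d-dimensional SFT with speed of convergence φ, it is not the case that φ(k) ≤ ψ(k) for all k; i.e. every speed of convergence of a realization of Σ eventually dominates every recursive function. -/

import Mathlib

/-- A `(1+e)`-dimensional pattern over the alphabet `B`, the first coordinate being the
distinguished direction. -/
structure Pat (e : ℕ) (B : Type*) where
  supp : Finset (ℤ × (Fin e → ℤ))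
  val : ℤ × (Fin e → ℤ) → B

/-- The configuration `x` avoids all patterns of `F`. -/
def avoids {e : ℕ} {B : Type*} (F : Set (Pat e B)) (x : ℤ × (Fin e → ℤ) → B) : Prop :=
  ∀ p ∈ F, ¬ ∃ t, ∀ u ∈ p.supp, p.val u = x (u + t)

/-- The configuration `x` avoids `F` wherever the translated support fits inside the
strip `ℤ × [-n,n]^e`. -/
def avoidsStrip {e : ℕ} {B : Type*} (F : Set (Pat e B)) (n : ℕ)
    (x : ℤ × (Fin e → ℤ) → B) : Prop :=
  ∀ p ∈ F, ∀ t : ℤ × (Fin e → ℤ),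
    (∀ u ∈ p.supp, ∀ i, |(u + t).2 i| ≤ (n : ℤ)) →
    ¬ (∀ u ∈ p.supp, p.val u = x (u + t))

/-- The one-dimensional projective subaction of the SFT `T_F` composed with the
letter-to-letter factor map `π` : central rows of images of configurations of `T_F`. -/
def SArow {e : ℕ} {A B : Type*} (F : Set (Pat e B)) (π : B → A) : Set (ℤ → A) :=
  {y | ∃ x : ℤ × (Fin e → ℤ) → B, avoids F x ∧ ∀ i : ℤ, y i = π (x (i, 0))}

/-- The width-`n` strip approximation of the previous projective subaction. -/
def RowApprox {e : ℕ} {A B : Type*} (F : Set (Pat e B)) (π : B → A) (n : ℕ) :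
    Set (ℤ → A) :=
  {y | ∃ x : ℤ × (Fin e → ℤ) → B, avoidsStrip F n x ∧ ∀ i : ℤ, y i = π (x (i, 0))}

/-- The language of words of length `k` of a set of configurations of `A^ℤ`. -/
def wordLang {A : Type*} (S : Set (ℤ → A)) (k : ℕ) : Set (Fin k → A) :=
  {w | ∃ y ∈ S, ∃ t : ℤ, ∀ i : Fin k, w i = y (t + (i : ℤ))}

/-- The folder set `Folder^{k2}_S(u)` of a word `u` of length `k1`. -/
def folderSet {A : Type*} (S : Set (ℤ → A)) (k1 k2 : ℕ) (u : Fin k1 → A) :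
    Set (Fin k2 → A) :=
  {v | v ∈ wordLang S k2 ∧
    ∃ y ∈ S, ∃ t : ℤ, (∀ i : Fin k1, u i = y (t + (i : ℤ))) ∧
      ∀ j : Fin k2, v j = y (t + (k1 : ℤ) + (j : ℤ))}

/-- The `n`-th Turing machine (partial recursive code) halts on the empty input. -/
def nthMachineHalts (n : ℕ) : Prop :=
  ((Denumerable.ofNat Nat.Partrec.Code n).eval 0).Dom

/-- The effective subshift `Σ = T_F ⊆ {0,1}^ℤ` with forbidden words
`0 1^n 0` for each `n` such that the `n`-th Turing machine halts. -/
def haltingShift : Set (ℤ → Bool) :=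
  {x | ∀ (i : ℤ) (n : ℕ),
    (x i = false ∧ (∀ t : ℤ, i < t → t ≤ i + n → x t = true) ∧ x (i + n + 1) = false) →
    ¬ nthMachineHalts n}

theorem exists_biinfinite_extension {C : Type*} [Fintype C] {W : ℕ}
    (Q : (ℤ → C) → Prop)
    (hQ : ∀ c c' : ℤ → C, (∀ m : ℕ, m < W → c m = c' m) → Q c → Q c')
    (c : ℤ → C) (L : ℕ)
    (hL : Fintype.card ((Fin W → C) × (Fin W → C)) ≤ L)
    (hc : ∀ i : ℤ, |i| ≤ L → Q (fun m => c (i + m))) :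
    ∃ c' : ℤ → C, (∀ m : ℕ, m < W → c' m = c m) ∧ ∀ i : ℤ, Q (fun m => c' (i + m)) := by
  classical
  let win : ℤ → Fin W → C := fun i m => c (i + (m : ℕ))
  have hwin : ∀ i j, win i = win j → ∀ m : ℕ, m < W → c (i + m) = c (j + m) :=
    fun i j h m hm => congrFun h ⟨m, hm⟩
  let f : ℕ → (Fin W → C) × (Fin W → C) := fun i => (win i, win (-i))
  obtain ⟨a, b, hab, hbL, hf⟩ : ∃ a b : ℕ, a < b ∧ b ≤ L ∧ f a = f b := by
    obtain ⟨a, b, hne, h⟩ := Fintype.exists_ne_map_eq_of_card_lt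
      (fun i : Fin (L + 1) => f i) (by simpa using Nat.lt_succ_of_le hL)
    rcases lt_or_gt_of_ne hne with h' | h'
    · exact ⟨a, b, h', by omega, h⟩
    · exact ⟨b, a, h', by omega, h.symm⟩
  let κ : ℕ → ℕ := fun i => (fun k => if k + 1 < b then k + 1 else a)^[i] 0
  have κ_zero : κ 0 = 0 := rfl
  have κ_succ : ∀ i, κ (i + 1) = if κ i + 1 < b then κ i + 1 else a :=
    fun i => Function.iterate_succ_apply' _ _ _
  have κ_lt : ∀ i, κ i < b := by
    intro i
    induction i with
    | zero => rw [κ_zero]; omega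
    | succ i ih => rw [κ_succ]; split_ifs <;> omega
  have f_κ : ∀ i, f (κ (i + 1)) = f (κ i + 1) := by
    intro i
    rw [κ_succ]
    split_ifs with h
    · rfl
    · rw [hf]
      congr 1
      have := κ_lt i
      omega
  let E : ℤ → ℤ := fun i => if 0 ≤ i then (κ i.toNat : ℤ) else -(κ (-i).toNat : ℤ)
  have E_nat : ∀ n : ℕ, E n = κ n := fun n => by simp [E]
  have E_neg : ∀ n : ℕ, E (-n) = -κ n := by
    intro n
    rcases Nat.eq_zero_or_pos n with rfl | hn
    · simp [E, κ_zero]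
    · simp [E, show n ≠ 0 by omega]
  have E_abs : ∀ i, |E i| ≤ L := by
    intro i
    rcases i.eq_nat_or_neg with ⟨n, rfl | rfl⟩
    · rw [E_nat]
      have := κ_lt n
      rw [abs_le]; omega
    · rw [E_neg]
      have := κ_lt n
      rw [abs_le]; omega
  have E_step : ∀ (m : ℕ), m + 1 < W → ∀ i, c (E i + (m + 1 : ℕ)) = c (E (i + 1) + m) := by
    intro m hm i
    rcases lt_or_ge i 0 with hi | hi
    · obtain ⟨n, rfl⟩ : ∃ n : ℕ, i = -((n + 1 : ℕ) : ℤ) := ⟨(-i).toNat - 1, by omega⟩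
      rw [E_neg, show -((n + 1 : ℕ) : ℤ) + 1 = -(n : ℤ) by push_cast; ring, E_neg,
        hwin _ _ (congrArg Prod.snd (f_κ n)) _ hm]
      congr 1
      push_cast
      ring
    · obtain ⟨n, rfl⟩ := Int.eq_ofNat_of_zero_le hi
      rw [E_nat, show (n : ℤ) + 1 = ((n + 1 : ℕ) : ℤ) by push_cast; ring, E_nat,
        hwin _ _ (congrArg Prod.fst (f_κ n)) _ (by omega)]
      congr 1
      push_cast
      ring
  have E_glue : ∀ m : ℕ, m < W → ∀ i, c (E i + m) = c (E (i + m)) := by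
    intro m
    induction m with
    | zero => simp
    | succ m ih =>
      intro hm i
      rw [E_step m hm, ih (by omega)]
      congr 2
      push_cast
      ring
  refine ⟨fun i => c (E i), fun m hm => ?_, fun i => ?_⟩
  · have h := E_glue m hm 0
    have h0 : E 0 = 0 := E_nat 0
    simpa [h0] using h.symm
  · exact hQ _ _ (fun m hm => E_glue m hm i) (hc _ (E_abs i))

/-- The configuration `x` avoids `F` wherever the translated support fits inside the
box `[-L,L] × [-N,N]^e`. -/
def avoidsBox {e : ℕ} {B : Type*} (F : Set (Pat e B)) (L N : ℕ)
    (x : ℤ × (Fin e → ℤ) → B) : Prop :=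
  ∀ p ∈ F, ∀ t : ℤ × (Fin e → ℤ),
    (∀ u ∈ p.supp, |(u + t).1| ≤ (L : ℤ) ∧ ∀ i, |(u + t).2 i| ≤ (N : ℤ)) →
    ¬ (∀ u ∈ p.supp, p.val u = x (u + t))

/-- The number of pairs of blocks of `W` columns in a strip `ℤ × [-N,N]^e`
over an alphabet of `b` letters. -/
def blockPairs (b e W N : ℕ) : ℕ :=
  (b ^ ((2 * N + 1) ^ e)) ^ W * (b ^ ((2 * N + 1) ^ e)) ^ W

theorem avoidsStrip.avoidsBox {e : ℕ} {B : Type*} {F : Set (Pat e B)} {N : ℕ}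
    {x : ℤ × (Fin e → ℤ) → B} (h : avoidsStrip F N x) (L : ℕ) : avoidsBox F L N x :=
  fun p hp t ht => h p hp t fun u hu => (ht u hu).2

theorem avoidsBox.exists_avoidsStrip {e : ℕ} {B : Type*} [Fintype B] {F : Set (Pat e B)}
    {D k N : ℕ} (hD : ∀ p ∈ F, ∀ u ∈ p.supp, |u.1| ≤ (D : ℤ)) {x : ℤ × (Fin e → ℤ) → B}
    (hx : avoidsBox F
      (blockPairs (Fintype.card B) e (2 * D + 1 + k) N + (2 * D + 1 + k)) N x) :
    ∃ x' : ℤ × (Fin e → ℤ) → B, avoidsStrip F N x' ∧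
      ∀ m : ℕ, m < k → x' ((m : ℤ), 0) = x ((m : ℤ), 0) := by
  classical
  let C := (Fin e → Finset.Icc (-N : ℤ) N) → B
  let read : C → (Fin e → ℤ) → B := fun w v =>
    if h : ∀ i, v i ∈ Finset.Icc (-N : ℤ) N then w (fun i => ⟨v i, h i⟩) else x 0
  let col : ℤ → C := fun i v => x (i, fun j => v j)
  have read_col : ∀ i (v : Fin e → ℤ), (∀ j, |v j| ≤ (N : ℤ)) → read (col i) v = x (i, v) := by
    intro i v hv
    have h : ∀ i, v i ∈ Finset.Icc (-N : ℤ) N := fun i => by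
      rw [Finset.mem_Icc, ← abs_le]; exact hv i
    exact dif_pos h
  let Q : (ℤ → C) → Prop := fun c => ∀ p ∈ F, ∀ s : Fin e → ℤ,
    (∀ u ∈ p.supp, ∀ i, |u.2 i + s i| ≤ (N : ℤ)) →
      ¬ ∀ u ∈ p.supp, p.val u = read (c (u.1 + D)) (u.2 + s)
  have hcard : Fintype.card ((Fin (2 * D + 1 + k) → C) × (Fin (2 * D + 1 + k) → C)) =
      blockPairs (Fintype.card B) e (2 * D + 1 + k) N := by
    have : ((N : ℤ) + 1 + N).toNat = 2 * N + 1 := by omega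
    simp [C, blockPairs, this]
  have hQ : ∀ c c' : ℤ → C, (∀ m : ℕ, m < 2 * D + 1 + k → c m = c' m) → Q c → Q c' := by
    intro c c' h hc p hp s hs hm
    refine hc p hp s hs fun u hu => ?_
    have hu' := abs_le.1 (hD p hp u hu)
    obtain ⟨m, hm'⟩ := Int.eq_ofNat_of_zero_le (show 0 ≤ u.1 + D by omega)
    rw [hm u hu, hm', h m (by omega)]
  have hcol : ∀ i : ℤ, |i| ≤ (blockPairs (Fintype.card B) e (2 * D + 1 + k) N : ℕ) →
      Q (fun m => col (i + m)) := by
    intro i hi p hp s hs hm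
    refine hx p hp (i + D, s) (fun u hu => ⟨?_, hs u hu⟩) fun u hu => ?_
    · have hu' := abs_le.1 (hD p hp u hu)
      rw [abs_le] at hi ⊢
      simp only [Prod.fst_add]
      push_cast
      omega
    · refine (hm u hu).trans ((read_col _ _ (hs u hu)).trans (congrArg x ?_))
      ext
      · simp only [Prod.fst_add]
        ring
      · rfl
  obtain ⟨c', hc', hQ'⟩ := exists_biinfinite_extension Q hQ col _ hcard.le hcol
  refine ⟨fun t => read (c' t.1) t.2, fun p hp t ht hm => ?_, fun m hm => ?_⟩
  · refine hQ' (t.1 - D) p hp t.2 ht fun u hu => ?_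
    have h : t.1 - D + (u.1 + D) = (u + t).1 := by simp only [Prod.fst_add]; ring
    rw [hm u hu]
    beta_reduce
    rw [h]
    rfl
  · change read (c' m) 0 = _
    rw [hc' m (by omega)]
    exact read_col _ _ (by simp)

/-- The letter at position `i` of the word `0 1^n 0`. -/
def haltingLetter (n i : ℕ) : Bool := decide (i ≠ 0 ∧ i ≠ n + 1)

theorem mem_wordLang_haltingShift {n : ℕ} :
    (fun i : Fin (n + 2) => haltingLetter n i) ∈ wordLang haltingShift (n + 2) ↔
      ¬ nthMachineHalts n := by
  constructor
  · rintro ⟨y, hy, t, ht⟩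
    have key : ∀ i : ℕ, i < n + 2 → y (t + i) = haltingLetter n i :=
      fun i hi => (ht ⟨i, hi⟩).symm
    refine hy t n ⟨?_, fun s hs hs' => ?_, ?_⟩
    · simpa [haltingLetter] using key 0 (by omega)
    · obtain ⟨m, hm⟩ := Int.eq_ofNat_of_zero_le (show 0 ≤ s - t by omega)
      rw [show s = t + m by omega, key m (by omega), haltingLetter]
      simp
      omega
    · simpa [haltingLetter, add_assoc] using key (n + 1) (by omega)
  · intro hn
    refine ⟨fun i => decide (i ≠ 0 ∧ i ≠ n + 1), ?_, 0, fun i => ?_⟩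
    · rintro i m ⟨h, h', h''⟩
      simp only [decide_eq_false_iff_not, decide_eq_true_eq] at h h' h''
      rcases lt_trichotomy m n with hm | rfl | hm
      · omega
      · exact hn
      · by_cases hi : i = 0
        · exact absurd (h' (n + 1) (by omega) (by omega)) (by simp)
        · omega
    · simp only [haltingLetter, zero_add]
      congr 1
      apply propext
      omega

theorem Primrec.natPow : Primrec₂ ((· ^ ·) : ℕ → ℕ → ℕ) :=
  Primrec₂.unpaired'.1 Nat.Primrec.pow

theorem Primrec.finset_sum {α ι : Type*} [Primcodable α] (s : Finset ι) {f : ι → α → ℕ}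
    (hf : ∀ i, Primrec (f i)) : Primrec fun a => ∑ i ∈ s, f i a := by
  classical
  induction s using Finset.induction_on with
  | empty => simpa using Primrec.const 0
  | insert i s hi ih =>
    simp only [Finset.sum_insert hi]
    exact Primrec.nat_add.comp (hf i) ih

theorem PrimrecPred.finset_forall {α ι : Type*} [Primcodable α] (s : Finset ι)
    {p : ι → α → Prop} (hp : ∀ i, PrimrecPred (p i)) : PrimrecPred fun a => ∀ i ∈ s, p i a := by
  classical
  induction s using Finset.induction_on with
  | empty =>
    exact PrimrecPred.of_eq (Primrec.eq.comp (Primrec.const 0) (Primrec.const 0)) (by simp)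
  | insert i s hi ih =>
    simp only [Finset.forall_mem_insert]
    exact (hp i).and ih

theorem PrimrecRel.forall_lt_nat {α : Type*} [Primcodable α] {R : ℕ → α → Prop}
    (hR : PrimrecRel R) : PrimrecRel fun n a => ∀ i < n, R i a :=
  (hR.forall_mem_list.comp (Primrec.list_range.comp Primrec.fst) Primrec.snd).of_eq (by simp)

theorem REPred.comp {α β : Type*} [Primcodable α] [Primcodable β] {p : β → Prop}
    (hp : REPred p) {f : α → β} (hf : Computable f) : REPred fun a => p (f a) :=
  Partrec.comp hp hf

theorem REPred.exists_of_computablePred {α β : Type*} [Primcodable α] [Primcodable β]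
    {R : α × β → Prop} (hR : ComputablePred R) : REPred fun a => ∃ b, R (a, b) := by
  obtain ⟨_, hR⟩ := hR
  have hf : Computable₂ fun (a : α) (n : ℕ) =>
      ((Encodable.decode n : Option β).map fun b => decide (R (a, b))).getD false :=
    Computable.option_getD
      (Computable.option_map (Computable.decode.comp Computable.snd)
        (hR.comp ((Computable.fst.comp Computable.fst).pair Computable.snd)).to₂)
      (Computable.const false)
  refine (Partrec.rfind hf.partrec₂).dom_re.of_eq fun a => ?_
  rw [Nat.rfind_dom']
  constructor
  · rintro ⟨n, hn, -⟩
    simp only [PFun.coe_val, Part.mem_some_iff] at hn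
    rcases h : (Encodable.decode n : Option β) with _ | b
    · simp [h] at hn
    · exact ⟨b, by simpa [h] using hn⟩
  · rintro ⟨b, hb⟩
    exact ⟨Encodable.encode b, by simp [hb], fun _ => trivial⟩

/-- All coordinates of a cell of `ℤ × ℤ^e`. -/
def coords {e : ℕ} (t : ℤ × (Fin e → ℤ)) : Fin (e + 1) → ℤ := Fin.cons t.1 t.2

theorem coords_add {e : ℕ} (u t : ℤ × (Fin e → ℤ)) (j : Fin (e + 1)) :
    coords (u + t) j = coords u j + coords t j := by
  refine Fin.cases ?_ (fun j => ?_) j <;> simp [coords]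

/-- The cell of the cube `[-O,O]^{1+e}` with base-`2O+1` digits those of `τ`. -/
def gridPoint {e : ℕ} (O τ : ℕ) : ℤ × (Fin e → ℤ) :=
  ((τ % (2 * O + 1) : ℕ) - O, fun j => (τ / (2 * O + 1) ^ ((j : ℕ) + 1) % (2 * O + 1) : ℕ) - O)

/-- The number whose base-`2O+1` digits are the coordinates of `t`, shifted by `O`. -/
def gridIndex {e : ℕ} (O : ℕ) (t : ℤ × (Fin e → ℤ)) : ℕ :=
  ∑ j : Fin (e + 1), (coords t j + O).toNat * (2 * O + 1) ^ (j : ℕ)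

/-- The configuration read off from a list of letters through `gridIndex`. -/
def listConfig {e : ℕ} {B : Type*} (b₀ : B) (O : ℕ) (l : List B) (t : ℤ × (Fin e → ℤ)) : B :=
  l.getD (gridIndex O t) b₀

theorem coords_gridPoint {e : ℕ} (O τ : ℕ) (j : Fin (e + 1)) :
    coords (gridPoint O τ) j = (τ / (2 * O + 1) ^ (j : ℕ) % (2 * O + 1) : ℕ) - (O : ℤ) := by
  refine Fin.cases ?_ (fun j => ?_) j <;> simp [coords, gridPoint]

theorem gridIndex_spec {e O : ℕ} {t : ℤ × (Fin e → ℤ)} (ht : ∀ j, |coords t j| ≤ (O : ℤ)) :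
    gridIndex O t < (2 * O + 1) ^ (e + 1) ∧ gridPoint O (gridIndex O t) = t := by
  have ht' := fun j => abs_le.1 (ht j)
  let d : Fin (e + 1) → Fin (2 * O + 1) := fun j =>
    ⟨(coords t j + O).toNat, by have := ht' j; omega⟩
  have hd : (finFunctionFinEquiv d : ℕ) = gridIndex O t := rfl
  refine ⟨hd ▸ (finFunctionFinEquiv d).2, ?_⟩
  have hc : ∀ j, coords (gridPoint O (gridIndex O t)) j = coords t j := by
    intro j
    have h : gridIndex O t / (2 * O + 1) ^ (j : ℕ) % (2 * O + 1) = (coords t j + O).toNat :=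
      congrArg Fin.val (congrFun (finFunctionFinEquiv.symm_apply_apply d) j)
    rw [coords_gridPoint, h]
    have := ht' j
    omega
  exact Prod.ext (hc 0) (funext fun j => hc j.succ)

theorem listConfig_map_range {e O : ℕ} {B : Type*} (b₀ : B) (x : ℤ × (Fin e → ℤ) → B)
    {t : ℤ × (Fin e → ℤ)} (ht : ∀ j, |coords t j| ≤ (O : ℤ)) :
    listConfig b₀ O ((List.range ((2 * O + 1) ^ (e + 1))).map fun τ => x (gridPoint O τ)) t =
      x t := by
  obtain ⟨hlt, heq⟩ := gridIndex_spec ht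
  simp [listConfig, List.getD_eq_getElem?_getD, hlt, heq]

/-- `avoidsBox` for the configuration of a list, with translations restricted to the
cube `[-O,O]^{1+e}`. -/
def listAvoidsBox {e : ℕ} {B : Type*} (F : Set (Pat e B)) (b₀ : B) (L N O : ℕ)
    (l : List B) : Prop :=
  ∀ τ < (2 * O + 1) ^ (e + 1), ∀ p ∈ F,
    (∀ u ∈ p.supp, |(u + gridPoint O τ).1| ≤ (L : ℤ) ∧
      ∀ i, |(u + gridPoint O τ).2 i| ≤ (N : ℤ)) →
    ¬ ∀ u ∈ p.supp, p.val u = listConfig b₀ O l (u + gridPoint O τ)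

theorem listAvoidsBox.avoidsBox {e : ℕ} {B : Type*} {F : Set (Pat e B)} {b₀ : B}
    {D L N O : ℕ} {l : List B} (hD : ∀ p ∈ F, ∀ u ∈ p.supp, ∀ j, |coords u j| ≤ (D : ℤ))
    (hO : L + N + D ≤ O) (h : listAvoidsBox F b₀ L N O l) :
    avoidsBox F L N (listConfig b₀ O l) := by
  intro p hp t ht hm
  rcases p.supp.eq_empty_or_nonempty with he | ⟨u, hu⟩
  · exact h 0 (by positivity) p hp (by simp [he]) (by simp [he])
  · obtain ⟨hlt, heq⟩ := gridIndex_spec (O := O) (t := t) fun j => by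
      have h1 := abs_le.1 (hD p hp u hu j)
      have h2 : |coords (u + t) j| ≤ ((L + N : ℕ) : ℤ) := by
        refine Fin.cases ?_ (fun j => ?_) j
        · have := (ht u hu).1
          simp only [coords, Fin.cons_zero]
          push_cast
          omega
        · have := (ht u hu).2 j
          simp only [coords, Fin.cons_succ]
          push_cast
          omega
      rw [coords_add, abs_le] at h2
      rw [abs_le]
      push_cast at h2
      omega
    exact h _ hlt p hp (by rwa [heq]) (by rwa [heq])

theorem avoidsBox.listAvoidsBox {e : ℕ} {B : Type*} {F : Set (Pat e B)} {L N O : ℕ}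
    {x : ℤ × (Fin e → ℤ) → B} (b₀ : B) (hO : L + N ≤ O) (h : avoidsBox F L N x) :
    listAvoidsBox F b₀ L N O
      ((List.range ((2 * O + 1) ^ (e + 1))).map fun τ => x (gridPoint O τ)) := by
  intro τ _ p hp ht hm
  refine h p hp _ ht fun u hu => ?_
  rw [hm u hu]
  refine listConfig_map_range b₀ x fun j => ?_
  obtain ⟨h1, h2⟩ := ht u hu
  refine Fin.cases ?_ (fun j => ?_) j
  · simp only [coords, Fin.cons_zero]
    omega
  · have := h2 j
    simp only [coords, Fin.cons_succ]
    omega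

section Primrec

variable {α : Type*} [Primcodable α] {e : ℕ} {L N O : α → ℕ}

theorem primrec_two_mul_add_one (hO : Primrec O) : Primrec fun a => 2 * O a + 1 :=
  Primrec.succ.comp (Primrec.nat_mul.comp (Primrec.const 2) hO)

theorem primrec_digit (hO : Primrec O) (j : ℕ) : Primrec fun q : ℕ × α =>
    q.1 / (2 * O q.2 + 1) ^ j % (2 * O q.2 + 1) :=
  have hH := primrec_two_mul_add_one (hO.comp (Primrec.snd (α := ℕ)))
  Primrec.nat_mod.comp (Primrec.nat_div.comp Primrec.fst
    (Primrec.natPow.comp hH (Primrec.const j))) hH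

theorem primrecPred_abs_coords_le (hO : Primrec O) {M : α → ℕ} (hM : Primrec M)
    (u : ℤ × (Fin e → ℤ)) (j : Fin (e + 1)) : PrimrecPred fun q : ℕ × α =>
      |coords (u + gridPoint (O q.2) q.1) j| ≤ (M q.2 : ℤ) := by
  have hd := primrec_digit hO j
  have hO' := hO.comp (Primrec.snd (α := ℕ))
  have hM' := hM.comp (Primrec.snd (α := ℕ))
  have hp := Primrec.const (α := ℕ × α) (coords u j).toNat
  have hn := Primrec.const (α := ℕ × α) (-coords u j).toNat
  refine ((Primrec.nat_le.comp (Primrec.nat_add.comp hO' hn)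
      (Primrec.nat_add.comp (Primrec.nat_add.comp hd hp) hM')).and
    (Primrec.nat_le.comp (Primrec.nat_add.comp hd hp)
      (Primrec.nat_add.comp (Primrec.nat_add.comp hO' hn) hM'))).of_eq fun q => ?_
  rw [coords_add, coords_gridPoint, abs_le]
  omega

theorem primrec_gridIndex_add (hO : Primrec O) (u : ℤ × (Fin e → ℤ)) :
    Primrec fun q : ℕ × α => gridIndex (O q.2) (u + gridPoint (O q.2) q.1) := by
  refine Primrec.finset_sum _ fun j => Primrec.nat_mul.comp ?_
    (Primrec.natPow.comp (primrec_two_mul_add_one (hO.comp Primrec.snd)) (Primrec.const _))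
  refine (Primrec.nat_sub.comp (Primrec.nat_add.comp (primrec_digit hO j)
    (Primrec.const (coords u j).toNat)) (Primrec.const (-coords u j).toNat)).of_eq fun q => ?_
  rw [coords_add, coords_gridPoint]
  omega

theorem primrecPred_listAvoidsBox {B : Type*} [Primcodable B] {F : Set (Pat e B)}
    (hF : F.Finite) (b₀ : B) (hL : Primrec L) (hN : Primrec N) (hO : Primrec O)
    {l : α → List B} (hl : Primrec l) :
    PrimrecPred fun a => listAvoidsBox F b₀ (L a) (N a) (O a) (l a) := by
  classical
  have h : PrimrecRel fun (τ : ℕ) (a : α) => ∀ p ∈ hF.toFinset,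
      ¬ ((∀ u ∈ p.supp, ∀ j ∈ Finset.univ, |coords (u + gridPoint (O a) τ) j| ≤
          ((Fin.cons (L a) (fun _ => N a) : Fin (e + 1) → ℕ) j : ℤ)) ∧
        ∀ u ∈ p.supp, p.val u = listConfig b₀ (O a) (l a) (u + gridPoint (O a) τ)) := by
    unfold PrimrecRel
    refine PrimrecPred.finset_forall _ fun p => PrimrecPred.not (PrimrecPred.and
      (PrimrecPred.finset_forall _ fun u => PrimrecPred.finset_forall _ fun j => ?_)
      (PrimrecPred.finset_forall _ fun u => ?_))
    · exact Fin.cases (primrecPred_abs_coords_le hO hL u 0)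
        (fun j => primrecPred_abs_coords_le hO hN u j.succ) j
    · exact Primrec.eq.comp (Primrec.const _) ((Primrec.list_getD b₀).comp
        (hl.comp Primrec.snd) (primrec_gridIndex_add hO u))
  refine (h.forall_lt_nat.comp (Primrec.natPow.comp
    (primrec_two_mul_add_one hO) (Primrec.const (e + 1))) Primrec.id).of_eq fun a => ?_
  refine forall₂_congr fun τ _ => ?_
  simp only [Set.Finite.mem_toFinset, not_and, Finset.mem_univ, true_imp_iff, Fin.forall_fin_succ]
  rfl

theorem primrec_gridIndex_row (hO : Primrec O) : Primrec fun q : ℕ × α =>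
    gridIndex (O q.2) ((q.1 : ℤ), (0 : Fin e → ℤ)) := by
  refine Primrec.finset_sum _ fun j => Primrec.nat_mul.comp ?_
    (Primrec.natPow.comp (primrec_two_mul_add_one (hO.comp Primrec.snd)) (Primrec.const _))
  refine Fin.cases ?_ (fun j => ?_) j
  · exact (Primrec.nat_add.comp Primrec.fst (hO.comp Primrec.snd)).of_eq fun q => by
      simp only [coords, Fin.cons_zero]
      omega
  · exact (hO.comp Primrec.snd).of_eq fun q => by simp [coords]

end Primrec

theorem RowApprox_anti {e : ℕ} {A B : Type*} (F : Set (Pat e B)) (π : B → A) {m n : ℕ}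
    (h : m ≤ n) : RowApprox F π n ⊆ RowApprox F π m := by
  rintro y ⟨x, hx, hy⟩
  exact ⟨x, fun p hp t ht => hx p hp t fun u hu i => (ht u hu i).trans (by exact_mod_cast h), hy⟩

theorem SArow_subset_RowApprox {e : ℕ} {A B : Type*} (F : Set (Pat e B)) (π : B → A) (n : ℕ) :
    SArow F π ⊆ RowApprox F π n := by
  rintro y ⟨x, hx, hy⟩
  exact ⟨x, fun p hp t _ hm => hx p hp ⟨t, hm⟩, hy⟩

theorem wordLang_mono {A : Type*} {S T : Set (ℤ → A)} (h : S ⊆ T) (k : ℕ) :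
    wordLang S k ⊆ wordLang T k :=
  fun _ ⟨y, hy, ht⟩ => ⟨y, h hy, ht⟩

theorem exists_coords_bound {e : ℕ} {B : Type*} {F : Set (Pat e B)} (hF : F.Finite) :
    ∃ D : ℕ, ∀ p ∈ F, ∀ u ∈ p.supp, ∀ j, |coords u j| ≤ (D : ℤ) := by
  refine ⟨hF.toFinset.sup fun p => p.supp.sup fun u =>
    Finset.univ.sup fun j => (coords u j).natAbs, fun p hp u hu j => ?_⟩
  rw [Int.abs_eq_natAbs, Int.ofNat_le]
  exact (Finset.le_sup (f := fun j => (coords u j).natAbs) (Finset.mem_univ j)).trans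
    ((Finset.le_sup (f := fun u => Finset.univ.sup fun j => (coords u j).natAbs) hu).trans
      (Finset.le_sup (f := fun p : Pat e B => p.supp.sup fun u =>
        Finset.univ.sup fun j => (coords u j).natAbs) (hF.mem_toFinset.2 hp)))

/-- Half-length of a box on which local admissibility implies extendability to the strip
of width `N`, keeping a central word of length `k`. -/
def boxLength (b e D k N : ℕ) : ℕ :=
  blockPairs b e (2 * D + 1 + k) N + (2 * D + 1 + k)

theorem mem_wordLang_RowApprox_iff {e : ℕ} {A B : Type*} [Fintype B] {F : Set (Pat e B)}
    {D : ℕ} (hD : ∀ p ∈ F, ∀ u ∈ p.supp, ∀ j, |coords u j| ≤ (D : ℤ)) (π : B → A) (b₀ : B)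
    {k N L O : ℕ} (hL : L = boxLength (Fintype.card B) e D k N) (hO : O = L + N + D)
    (w : ℕ → A) :
    (fun i : Fin k => w i) ∈ wordLang (RowApprox F π N) k ↔
      ∃ l : List B, listAvoidsBox F b₀ L N O l ∧
        ∀ i < k, π (listConfig b₀ O l ((i : ℤ), (0 : Fin e → ℤ))) = w i := by
  constructor
  · rintro ⟨y, ⟨x, hx, hy⟩, t, ht⟩
    have hx' : avoidsStrip F N fun s => x (s + (t, 0)) := by
      intro p hp s hs hm
      exact hx p hp (s + (t, 0)) (fun u hu i => by simpa using hs u hu i)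
        fun u hu => (hm u hu).trans (congrArg x (add_assoc u s (t, 0)))
    refine ⟨_, (hx'.avoidsBox L).listAvoidsBox b₀ (by omega), fun i hi => ?_⟩
    rw [listConfig_map_range b₀ fun s => x (s + (t, 0))]
    · rw [show w i = y (t + i) from ht ⟨i, hi⟩, hy]
      simp [add_comm]
    · have : k ≤ L := by rw [hL, boxLength]; omega
      refine Fin.cases ?_ (fun j => ?_)
      · simp only [coords, Fin.cons_zero]
        rw [abs_le]
        omega
      · simp [coords]
  · rintro ⟨l, hl, hw⟩
    have hbox := hl.avoidsBox hD hO.ge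
    rw [hL, boxLength] at hbox
    obtain ⟨x, hx, hxk⟩ := hbox.exists_avoidsStrip fun p hp u hu => hD p hp u hu 0
    refine ⟨fun i => π (x (i, 0)), ⟨x, hx, fun _ => rfl⟩, 0, fun i => ?_⟩
    beta_reduce
    rw [zero_add, hxk i i.2, hw i i.2]

theorem primrec_boxLength (b e D : ℕ) : Primrec₂ (boxLength b e D) := by
  have hW : Primrec fun q : ℕ × ℕ => 2 * D + 1 + q.1 :=
    Primrec.nat_add.comp (Primrec.const _) Primrec.fst
  have hp := Primrec.natPow.comp (Primrec.natPow.comp (Primrec.const b)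
    (Primrec.natPow.comp (primrec_two_mul_add_one Primrec.snd) (Primrec.const e))) hW
  exact Primrec.nat_add.comp (Primrec.nat_mul.comp hp hp) hW

theorem primrec_haltingLetter : Primrec₂ haltingLetter := by
  have h : PrimrecPred fun q : ℕ × ℕ => q.2 ≠ 0 ∧ q.2 ≠ q.1 + 1 :=
    (PrimrecPred.not (Primrec.eq.comp Primrec.snd (Primrec.const 0))).and
      (PrimrecPred.not (Primrec.eq.comp Primrec.snd (Primrec.succ.comp Primrec.fst)))
  exact h.decide

/-- It is semi-decidable whether `0 1^n 0` occurs in the strip approximation of width `N`. -/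
theorem rePred_mem_wordLang_RowApprox {e : ℕ} {B : Type*} [Fintype B] [Nonempty B]
    {F : Set (Pat e B)} (hF : F.Finite) (π : B → Bool) :
    REPred fun q : ℕ × ℕ =>
      (fun i : Fin (q.1 + 2) => haltingLetter q.1 i) ∈
        wordLang (RowApprox F π q.2) (q.1 + 2) := by
  obtain ⟨D, hD⟩ := exists_coords_bound hF
  let _ : Primcodable B := Primcodable.ofEquiv _ (Fintype.equivFin B)
  obtain ⟨b₀⟩ := ‹Nonempty B›
  obtain ⟨L, hLdef⟩ : ∃ L : ℕ × ℕ → ℕ,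
      ∀ q, L q = boxLength (Fintype.card B) e D (q.1 + 2) q.2 := ⟨_, fun _ => rfl⟩
  obtain ⟨O, hOdef⟩ : ∃ O : ℕ × ℕ → ℕ, ∀ q, O q = L q + q.2 + D := ⟨_, fun _ => rfl⟩
  have hk : Primrec fun q : ℕ × ℕ => q.1 + 2 :=
    Primrec.nat_add.comp Primrec.fst (Primrec.const 2)
  have hL : Primrec L :=
    ((primrec_boxLength _ e D).comp hk Primrec.snd).of_eq fun q => (hLdef q).symm
  have hO : Primrec O := (Primrec.nat_add.comp (Primrec.nat_add.comp hL Primrec.snd)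
    (Primrec.const D)).of_eq fun q => (hOdef q).symm
  have hfst : Primrec fun r : (ℕ × ℕ) × List B => r.1 := Primrec.fst
  have hword : PrimrecRel fun (i : ℕ) (r : (ℕ × ℕ) × List B) =>
      π (listConfig b₀ (O r.1) r.2 ((i : ℤ), (0 : Fin e → ℤ))) = haltingLetter r.1.1 i :=
    Primrec.eq.comp ((Primrec.dom_finite π).comp ((Primrec.list_getD b₀).comp
      (Primrec.snd.comp Primrec.snd) (primrec_gridIndex_row (hO.comp hfst))))
      (primrec_haltingLetter.comp (Primrec.fst.comp (hfst.comp Primrec.snd)) Primrec.fst)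
  have hcheck : PrimrecPred fun r : (ℕ × ℕ) × List B =>
      listAvoidsBox F b₀ (L r.1) r.1.2 (O r.1) r.2 ∧
        ∀ i < r.1.1 + 2,
          π (listConfig b₀ (O r.1) r.2 ((i : ℤ), (0 : Fin e → ℤ))) = haltingLetter r.1.1 i :=
    (primrecPred_listAvoidsBox hF b₀ (hL.comp hfst) (Primrec.snd.comp hfst) (hO.comp hfst)
      Primrec.snd).and (hword.forall_lt_nat.comp (hk.comp hfst) Primrec.id)
  exact (REPred.exists_of_computablePred hcheck.computablePred).of_eq fun q =>
    (mem_wordLang_RowApprox_iff hD π b₀ (hLdef q) (hOdef q) (haltingLetter q.1)).symm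

/-- For the halting-problem subshift, no sofic realization has a recursively bounded
speed of convergence: for every realization of `Σ` as a projective subaction of a
`(1+e)`-dimensional SFT (composed with a letter-to-letter factor) with speed of
convergence `φ`, and every total computable `ψ`, it is not the case that `φ(k) ≤ ψ(k)`
for all `k`. -/
theorem halting_shift_speed_not_recursive {B : Type} [Fintype B] {e : ℕ}
    (F : Set (Pat e B)) (hF : F.Finite) (π : B → Bool) (φ : ℕ → ℕ)
    (hreal : SArow F π = haltingShift)
    (hφ : ∀ k : ℕ, ∀ u : Fin k → Bool,
      u ∉ wordLang (SArow F π) k → u ∉ wordLang (RowApprox F π (φ k)) k)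
    (ψ : ℕ → ℕ) (hψ : Computable ψ) :
    ¬ ∀ k, φ k ≤ ψ k := by
  intro hle
  have : Nonempty B := by
    have h : (fun _ => true) ∈ haltingShift := fun _ _ h => by simp at h
    obtain ⟨x, -⟩ := hreal ▸ h
    exact ⟨x 0⟩
  have key : ∀ n, (fun i : Fin (n + 2) => haltingLetter n i) ∈
      wordLang (RowApprox F π (ψ (n + 2))) (n + 2) ↔ ¬ nthMachineHalts n := by
    intro n
    rw [← mem_wordLang_haltingShift, ← hreal]
    refine ⟨fun h => ?_, fun h => wordLang_mono (SArow_subset_RowApprox F π _) _ h⟩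
    by_contra hn
    exact hφ _ _ hn (wordLang_mono (RowApprox_anti F π (hle _)) _ h)
  have hcomp : Computable fun c : Nat.Partrec.Code =>
      (Encodable.encode c, ψ (Encodable.encode c + 2)) :=
    Computable.encode.pair (hψ.comp (Primrec.nat_add.to_comp.comp Computable.encode
      (Computable.const 2)))
  refine ComputablePred.halting_problem_not_re 0 ?_
  refine ((rePred_mem_wordLang_RowApprox hF π).comp hcomp).of_eq fun c => ?_
  rw [key, nthMachineHalts, Denumerable.ofNat_encode]
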